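/- The R-matrix R(u) = I + P/u − K/(u+κ), with 2κ = (M−N−2)θ₀, satisfies the (super) Yang–Baxter equation R₁₂(u) R₁₃(u+v) R₂₃(v) = R₂₃(v) R₁₃(u+v) R₁₂(u) on the graded triple tensor product. -/

import Mathlib

open Matrix BigOperators Finset

noncomputable section

namespace OspYangian

variable (M N : ℕ) (θ₀ : ℤ)

/-- The grading exponent `[i] ∈ {0,1}`, defined so that `(-1)^[i] = θ₀` for `i < M`
and `(-1)^[i] = -θ₀` for `M ≤ i < M+N` (0-indexed). -/
def gr (i : Fin (M + N)) : ℕ :=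
  if (i : ℕ) < M then (if θ₀ = 1 then 0 else 1) else (if θ₀ = 1 then 1 else 0)

/-- The sign `θ_i`: `+1` for `i < M + N/2`, `-1` otherwise (0-indexed). -/
def th (i : Fin (M + N)) : ℂ :=
  if (i : ℕ) < M + N / 2 then 1 else -1

/-- The conjugate index `ī`: `M+1-i` resp. `2M+N+1-i` in 1-indexed notation. -/
def bar (i : Fin (M + N)) : Fin (M + N) :=
  if _h : (i : ℕ) < M then ⟨M - 1 - (i : ℕ), by omega⟩
  else ⟨2 * M + N - 1 - (i : ℕ), by have := i.isLt; omega⟩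

/-- Coefficient matrices of elements of the graded tensor square of `gl(M|N)`:
the entry at `((i,k),(j,l))` is the coefficient of `E_{ij} ⊗ E_{kl}`. -/
abbrev Mat := Matrix (Fin (M + N) × Fin (M + N)) (Fin (M + N) × Fin (M + N)) ℂ

/-- Multiplication in the graded tensor product algebra:
`(A⊗B)(C⊗D) = (-1)^{[B][C]} AC ⊗ BD` on homogeneous elements. -/
def gmul (A B : Mat M N) : Mat M N := fun p q =>
  ∑ j : Fin (M + N), ∑ l : Fin (M + N),
    (-1 : ℂ) ^ ((gr M N θ₀ p.2 + gr M N θ₀ l) * (gr M N θ₀ j + gr M N θ₀ q.1)) *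
      A p (j, l) * B (j, l) q

/-- The superpermutation `P = Σ_{i,j} (-1)^{[j]} E_{ij} ⊗ E_{ji}`. -/
def P : Mat M N := fun p q =>
  if p.1 = q.2 ∧ p.2 = q.1 then (-1 : ℂ) ^ gr M N θ₀ p.2 else 0

/-- `K = Σ_{i,j} (-1)^{[i][j]} θ_i θ_j E_{j̄ ī} ⊗ E_{ji}`. -/
def K : Mat M N := fun p q =>
  if p.1 = bar M N p.2 ∧ q.1 = bar M N q.2 then
    (-1 : ℂ) ^ (gr M N θ₀ q.2 * gr M N θ₀ p.2) * th M N q.2 * th M N p.2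
  else 0

/-- Coefficient matrices of elements of the graded triple tensor product. -/
abbrev Mat3 := Matrix (Fin (M + N) × Fin (M + N) × Fin (M + N))
  (Fin (M + N) × Fin (M + N) × Fin (M + N)) ℂ

/-- Multiplication in the graded triple tensor product algebra: the sign is
`(-1)^{(d₂+d₃)e₁ + d₃e₂}` where `d_a`, `e_a` are the degrees of the `a`-th factors. -/
def gmul3 (A B : Mat3 M N) : Mat3 M N := fun p q =>
  ∑ m : Fin (M + N) × Fin (M + N) × Fin (M + N),
    (-1 : ℂ) ^ ((gr M N θ₀ p.2.1 + gr M N θ₀ m.2.1 + gr M N θ₀ p.2.2 + gr M N θ₀ m.2.2) *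
          (gr M N θ₀ m.1 + gr M N θ₀ q.1) +
        (gr M N θ₀ p.2.2 + gr M N θ₀ m.2.2) * (gr M N θ₀ m.2.1 + gr M N θ₀ q.2.1)) *
      A p m * B m q

/-- Embedding `X ↦ X₁₂ = X ⊗ I` into the triple tensor product. -/
def emb12 (X : Mat M N) : Mat3 M N := fun p q =>
  if p.2.2 = q.2.2 then X (p.1, p.2.1) (q.1, q.2.1) else 0

/-- Embedding `X ↦ X₁₃` into the triple tensor product. -/
def emb13 (X : Mat M N) : Mat3 M N := fun p q =>
  if p.2.1 = q.2.1 then X (p.1, p.2.2) (q.1, q.2.2) else 0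

/-- Embedding `X ↦ X₂₃ = I ⊗ X` into the triple tensor product. -/
def emb23 (X : Mat M N) : Mat3 M N := fun p q =>
  if p.1 = q.1 then X p.2 q.2 else 0

/-- `κ` with `2κ = (M - N - 2)θ₀`. -/
def kap : ℂ := (((M : ℂ) - (N : ℂ) - 2) * (θ₀ : ℂ)) / 2

/-- The rational R-matrix `R(u) = I + P/u - K/(u+κ)`. -/
def R (u : ℂ) : Mat M N :=
  1 + u⁻¹ • P M N θ₀ - (u + kap M N θ₀)⁻¹ • K M N θ₀

theorem yang_baxter_of_brauer_relations {A : Type*} [Ring A] [Algebra ℂ A] {s₁ s₂ e : A}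
    {t ω κ u v : ℂ} (ht : t = 1 ∨ t = -1) (hκ : κ = (ω - 2) * t / 2)
    (h₁ : s₁ * s₁ = 1) (h₂ : s₂ * s₂ = 1) (hb : s₂ * (s₁ * s₂) = s₁ * (s₂ * s₁))
    (hse : s₁ * e = t • e) (hes : e * s₁ = t • e) (hee : e * e = (ω * t) • e)
    (hese : e * (s₂ * e) = e)
    (hu : u ≠ 0) (hv : v ≠ 0) (huv : u + v ≠ 0)
    (huk : u + κ ≠ 0) (hvk : v + κ ≠ 0) (huvk : u + v + κ ≠ 0) :
    (1 + u⁻¹ • s₁ - (u + κ)⁻¹ • e) *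
        ((1 + (u + v)⁻¹ • (s₁ * s₂ * s₁) - (u + v + κ)⁻¹ • (s₂ * e * s₂)) *
          (1 + v⁻¹ • s₂ - (v + κ)⁻¹ • (s₁ * s₂ * e * s₂ * s₁))) =
      (1 + v⁻¹ • s₂ - (v + κ)⁻¹ • (s₁ * s₂ * e * s₂ * s₁)) *
        ((1 + (u + v)⁻¹ • (s₁ * s₂ * s₁) - (u + v + κ)⁻¹ • (s₂ * e * s₂)) *
          (1 + u⁻¹ • s₁ - (u + κ)⁻¹ • e)) := by
  have h₁' (x : A) : s₁ * (s₁ * x) = x := by rw [← mul_assoc, h₁, one_mul]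
  have h₂' (x : A) : s₂ * (s₂ * x) = x := by rw [← mul_assoc, h₂, one_mul]
  have hb' (x : A) : s₂ * (s₁ * (s₂ * x)) = s₁ * (s₂ * (s₁ * x)) := by
    simpa only [mul_assoc] using congrArg (· * x) hb
  have hse' (x : A) : s₁ * (e * x) = t • (e * x) := by
    rw [← mul_assoc, hse, smul_mul_assoc]
  have hes' (x : A) : e * (s₁ * x) = t • (e * x) := by
    rw [← mul_assoc, hes, smul_mul_assoc]
  have hee' (x : A) : e * (e * x) = (ω * t) • (e * x) := by
    rw [← mul_assoc, hee, smul_mul_assoc]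
  have hese' (x : A) : e * (s₂ * (e * x)) = e * x := by
    simpa only [mul_assoc] using congrArg (· * x) hese
  have hω : ω = 2 * κ * t + 2 := by
    rcases ht with rfl | rfl <;> rw [hκ] <;> ring
  clear hκ
  subst hω
  simp only [mul_add, add_mul, mul_sub, sub_mul, mul_one, one_mul, smul_mul_assoc,
    mul_smul_comm, mul_assoc, h₁, h₂, hb, hse, hes, hee, hese, h₁', h₂', hb', hse', hes', hee',
    hese', smul_smul]
  rcases ht with rfl | rfl
  all_goals
    match_scalars <;> field_simp <;> ring

variable {M N θ₀}

lemma bar_bar (i : Fin (M + N)) : bar M N (bar M N i) = i := by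
  have := i.isLt
  by_cases h : (i : ℕ) < M
  · have h' : M - 1 - (i : ℕ) < M := by omega
    ext
    simp only [bar, h, h', dif_pos]
    omega
  · have h' : ¬ 2 * M + N - 1 - (i : ℕ) < M := by omega
    ext
    simp only [bar, h, h', dif_neg, not_false_eq_true]
    omega

lemma bar_eq_iff {i j : Fin (M + N)} : bar M N i = j ↔ i = bar M N j := by
  constructor
  · rintro rfl; rw [bar_bar]
  · rintro rfl; rw [bar_bar]

lemma gr_bar (i : Fin (M + N)) : gr M N θ₀ (bar M N i) = gr M N θ₀ i := by
  have := i.isLt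
  have : ((bar M N i : Fin (M + N)) : ℕ) < M ↔ (i : ℕ) < M := by
    unfold bar
    split_ifs <;> simp <;> omega
  simp only [gr, this]

/-- The sign `(-1)^[i]`. -/
def parity (M N : ℕ) (θ₀ : ℤ) (i : Fin (M + N)) : ℂ := (-1) ^ gr M N θ₀ i

lemma th_mul_self (i : Fin (M + N)) : th M N i * th M N i = 1 := by
  unfold th; split_ifs <;> norm_num

lemma th_bar (hθ : θ₀ = 1 ∨ θ₀ = -1) (hN : Even N) (i : Fin (M + N)) :
    th M N (bar M N i) = θ₀ * parity M N θ₀ i * th M N i := by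
  have := i.isLt
  obtain ⟨n, rfl⟩ := hN
  have hi : (i : ℕ) < M → (i : ℕ) < M + (n + n) / 2 := by omega
  have hb : ((bar M (n + n) i : Fin (M + (n + n))) : ℕ) < M + (n + n) / 2 ↔
      ((i : ℕ) < M ∨ ¬ (i : ℕ) < M + (n + n) / 2) := by
    unfold bar
    split_ifs <;> simp <;> omega
  unfold th parity gr
  simp only [hb]
  by_cases h : (i : ℕ) < M
  · rcases hθ with rfl | rfl <;> simp [h, hi h]
  · rcases hθ with rfl | rfl <;> by_cases h' : (i : ℕ) < M + (n + n) / 2 <;> simp [h, h']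

lemma sum_parity (hθ : θ₀ = 1 ∨ θ₀ = -1) :
    ∑ i, parity M N θ₀ i = ((M : ℂ) - N) * θ₀ := by
  rw [Fin.sum_univ_add]
  rcases hθ with rfl | rfl <;> simp [parity, gr] <;> ring

lemma parity_mul_self (i : Fin (M + N)) : parity M N θ₀ i * parity M N θ₀ i = 1 := by
  rw [parity, ← mul_pow]; norm_num

/-- The sign `(-1)^{[i][j]}`. -/
def braidSign (M N : ℕ) (θ₀ : ℤ) (i j : Fin (M + N)) : ℂ := (-1) ^ (gr M N θ₀ i * gr M N θ₀ j)

lemma braidSign_mul_self (i j : Fin (M + N)) :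
    braidSign M N θ₀ i j * braidSign M N θ₀ i j = 1 := by
  rw [braidSign, ← mul_pow]; norm_num

lemma braidSign_comm (i j : Fin (M + N)) : braidSign M N θ₀ i j = braidSign M N θ₀ j i := by
  rw [braidSign, braidSign, mul_comm]

lemma gr_eq_zero_or_one (i : Fin (M + N)) : gr M N θ₀ i = 0 ∨ gr M N θ₀ i = 1 := by
  unfold gr; split_ifs <;> simp

lemma braidSign_self (i : Fin (M + N)) : braidSign M N θ₀ i i = parity M N θ₀ i := by
  rcases gr_eq_zero_or_one (θ₀ := θ₀) i with h | h <;> simp [braidSign, parity, h]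

lemma braidSign_bar_left (i j : Fin (M + N)) :
    braidSign M N θ₀ (bar M N i) j = braidSign M N θ₀ i j := by
  rw [braidSign, gr_bar, braidSign]

lemma parity_bar (i : Fin (M + N)) : parity M N θ₀ (bar M N i) = parity M N θ₀ i := by
  rw [parity, gr_bar, parity]

/-- The matrix of the operator on the triple tensor power of superspaces defined by an element
of the graded triple tensor product. -/
def toOp (M N : ℕ) (θ₀ : ℤ) : Mat3 M N →ₗ[ℂ] Mat3 M N where
  toFun A := fun p q =>
    (-1 : ℂ) ^ ((gr M N θ₀ p.2.1 + gr M N θ₀ q.2.1) * gr M N θ₀ q.1 +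
      (gr M N θ₀ p.2.2 + gr M N θ₀ q.2.2) * (gr M N θ₀ q.1 + gr M N θ₀ q.2.1)) * A p q
  map_add' A B := by ext p q; exact mul_add _ _ _
  map_smul' c A := by ext p q; exact mul_left_comm _ _ _

lemma toOp_apply (A : Mat3 M N) (p q : Fin (M + N) × Fin (M + N) × Fin (M + N)) :
    toOp M N θ₀ A p q =
      (-1 : ℂ) ^ ((gr M N θ₀ p.2.1 + gr M N θ₀ q.2.1) * gr M N θ₀ q.1 +
        (gr M N θ₀ p.2.2 + gr M N θ₀ q.2.2) * (gr M N θ₀ q.1 + gr M N θ₀ q.2.1)) * A p q :=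
  rfl

lemma toOp_injective : Function.Injective (toOp M N θ₀) := by
  intro A B h
  ext p q
  have := congrFun (congrFun h p) q
  rw [toOp_apply, toOp_apply] at this
  exact mul_left_cancel₀ (pow_ne_zero _ (by norm_num)) this

lemma toOp_gmul3 (A B : Mat3 M N) :
    toOp M N θ₀ (gmul3 M N θ₀ A B) = toOp M N θ₀ A * toOp M N θ₀ B := by
  ext p q
  rw [toOp_apply, Matrix.mul_apply, gmul3, Finset.mul_sum]
  refine Finset.sum_congr rfl fun m _ => ?_
  rw [toOp_apply, toOp_apply, ← mul_assoc, ← mul_assoc, ← pow_add, mul_mul_mul_comm, ← pow_add,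
    ← mul_assoc]
  congr 2
  generalize gr M N θ₀ p.2.1 = p₂, gr M N θ₀ p.2.2 = p₃, gr M N θ₀ m.1 = m₁,
    gr M N θ₀ m.2.1 = m₂, gr M N θ₀ m.2.2 = m₃, gr M N θ₀ q.1 = q₁, gr M N θ₀ q.2.1 = q₂,
    gr M N θ₀ q.2.2 = q₃
  rw [show (p₂ + q₂) * q₁ + (p₃ + q₃) * (q₁ + q₂) +
      ((p₂ + m₂ + p₃ + m₃) * (m₁ + q₁) + (p₃ + m₃) * (m₂ + q₂)) =
    (p₂ + m₂) * m₁ + (p₃ + m₃) * (m₁ + m₂) +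
      ((m₂ + q₂) * q₁ + (m₃ + q₃) * (q₁ + q₂)) +
      2 * (p₂ * q₁ + p₃ * q₁ + p₃ * q₂) by ring, pow_add _ _ (2 * _), pow_mul]
  simp

/-- The operator of `P₁₂`: the superpermutation of the first two factors. -/
def swap12 (M N : ℕ) (θ₀ : ℤ) : Mat3 M N := fun p q =>
  if q = (p.2.1, p.1, p.2.2) then braidSign M N θ₀ p.1 p.2.1 else 0

/-- The operator of `P₂₃`: the superpermutation of the last two factors. -/
def swap23 (M N : ℕ) (θ₀ : ℤ) : Mat3 M N := fun p q =>
  if q = (p.1, p.2.2, p.2.1) then braidSign M N θ₀ p.2.1 p.2.2 else 0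

/-- The operator of `K₁₂`. -/
def contract12 (M N : ℕ) (θ₀ : ℤ) : Mat3 M N := fun p q =>
  if p.1 = bar M N p.2.1 ∧ q.1 = bar M N q.2.1 ∧ p.2.2 = q.2.2 then
    parity M N θ₀ q.2.1 * th M N q.2.1 * th M N p.2.1 else 0

lemma swap12_mul (A : Mat3 M N) (p q : Fin (M + N) × Fin (M + N) × Fin (M + N)) :
    (swap12 M N θ₀ * A) p q = braidSign M N θ₀ p.1 p.2.1 * A (p.2.1, p.1, p.2.2) q := by
  simp [Matrix.mul_apply, swap12]

lemma swap23_mul (A : Mat3 M N) (p q : Fin (M + N) × Fin (M + N) × Fin (M + N)) :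
    (swap23 M N θ₀ * A) p q = braidSign M N θ₀ p.2.1 p.2.2 * A (p.1, p.2.2, p.2.1) q := by
  simp [Matrix.mul_apply, swap23]

lemma mul_swap12 (A : Mat3 M N) (p q : Fin (M + N) × Fin (M + N) × Fin (M + N)) :
    (A * swap12 M N θ₀) p q = A p (q.2.1, q.1, q.2.2) * braidSign M N θ₀ q.1 q.2.1 := by
  have h (m : Fin (M + N) × Fin (M + N) × Fin (M + N)) :
      swap12 M N θ₀ m q =
        if m = (q.2.1, q.1, q.2.2) then braidSign M N θ₀ q.1 q.2.1 else 0 := by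
    obtain ⟨a, b, c⟩ := q
    obtain ⟨x, y, z⟩ := m
    simp only [swap12, Prod.mk.injEq]
    split_ifs <;> simp_all [braidSign_comm]
  simp [Matrix.mul_apply, h]

lemma mul_swap23 (A : Mat3 M N) (p q : Fin (M + N) × Fin (M + N) × Fin (M + N)) :
    (A * swap23 M N θ₀) p q = A p (q.1, q.2.2, q.2.1) * braidSign M N θ₀ q.2.1 q.2.2 := by
  have h (m : Fin (M + N) × Fin (M + N) × Fin (M + N)) :
      swap23 M N θ₀ m q =
        if m = (q.1, q.2.2, q.2.1) then braidSign M N θ₀ q.2.1 q.2.2 else 0 := by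
    obtain ⟨a, b, c⟩ := q
    obtain ⟨x, y, z⟩ := m
    simp only [swap23, Prod.mk.injEq]
    split_ifs <;> simp_all [braidSign_comm]
  simp [Matrix.mul_apply, h]

lemma contract12_mul (A : Mat3 M N) (p q : Fin (M + N) × Fin (M + N) × Fin (M + N)) :
    (contract12 M N θ₀ * A) p q = if p.1 = bar M N p.2.1 then
      ∑ x, parity M N θ₀ x * th M N x * th M N p.2.1 * A (bar M N x, x, p.2.2) q else 0 := by
  have h (a b c : Fin (M + N)) : contract12 M N θ₀ p (a, b, c) =
      if p.1 = bar M N p.2.1 then if p.2.2 = c then if a = bar M N b then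
        parity M N θ₀ b * th M N b * th M N p.2.1 else 0 else 0 else 0 := by
    simp only [contract12]
    split_ifs <;> simp_all
  rw [Matrix.mul_apply, Fintype.sum_prod_type_right]
  simp only [Fintype.sum_prod_type, h]
  split_ifs <;> simp

lemma swap12_mul_self : swap12 M N θ₀ * swap12 M N θ₀ = 1 := by
  ext p q
  rw [swap12_mul, Matrix.one_apply, swap12]
  simp only [Prod.mk.eta, eq_comm (a := q), mul_ite, mul_zero,
    braidSign_comm p.2.1, braidSign_mul_self]

lemma swap23_mul_self : swap23 M N θ₀ * swap23 M N θ₀ = 1 := by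
  ext p q
  rw [swap23_mul, Matrix.one_apply, swap23]
  simp only [Prod.mk.eta, eq_comm (a := q), mul_ite, mul_zero,
    braidSign_comm p.2.2, braidSign_mul_self]

lemma swap_braid :
    swap23 M N θ₀ * (swap12 M N θ₀ * swap23 M N θ₀) =
      swap12 M N θ₀ * (swap23 M N θ₀ * swap12 M N θ₀) := by
  ext p q
  simp only [swap12_mul, swap23_mul]
  simp only [swap12, swap23, mul_ite, mul_zero]
  congr 1
  ring

lemma swap12_mul_contract12 (hθ : θ₀ = 1 ∨ θ₀ = -1) (hN : Even N) :
    swap12 M N θ₀ * contract12 M N θ₀ = (θ₀ : ℂ) • contract12 M N θ₀ := by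
  ext ⟨p₁, p₂, p₃⟩ ⟨q₁, q₂, q₃⟩
  simp only [swap12_mul, Matrix.smul_apply, contract12, smul_eq_mul]
  by_cases h : p₁ = bar M N p₂
  · subst h
    simp only [bar_bar, true_and, braidSign_bar_left, braidSign_self, th_bar hθ hN]
    split_ifs
    · linear_combination (parity M N θ₀ q₂ * th M N q₂ * θ₀ * th M N p₂) *
        parity_mul_self (θ₀ := θ₀) p₂
    · simp
  · have h' : ¬ p₂ = bar M N p₁ := fun e => h (by rw [e, bar_bar])
    simp [h, h']

lemma contract12_mul_swap12 (hθ : θ₀ = 1 ∨ θ₀ = -1) (hN : Even N) :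
    contract12 M N θ₀ * swap12 M N θ₀ = (θ₀ : ℂ) • contract12 M N θ₀ := by
  ext ⟨p₁, p₂, p₃⟩ ⟨q₁, q₂, q₃⟩
  simp only [mul_swap12, Matrix.smul_apply, contract12, smul_eq_mul]
  by_cases h : q₁ = bar M N q₂
  · subst h
    simp only [bar_bar, true_and, braidSign_bar_left, braidSign_self, parity_bar, th_bar hθ hN]
    split_ifs
    · linear_combination (parity M N θ₀ q₂ * th M N q₂ * θ₀ * th M N p₂) *
        parity_mul_self (θ₀ := θ₀) q₂
    · simp
  · have h' : ¬ q₂ = bar M N q₁ := fun e => h (by rw [e, bar_bar])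
    simp [h, h']

lemma contract12_mul_self (hθ : θ₀ = 1 ∨ θ₀ = -1) :
    contract12 M N θ₀ * contract12 M N θ₀ = (((M : ℂ) - N) * θ₀) • contract12 M N θ₀ := by
  ext ⟨p₁, p₂, p₃⟩ ⟨q₁, q₂, q₃⟩
  rw [contract12_mul, Matrix.smul_apply, smul_eq_mul, ← sum_parity hθ, Finset.sum_mul]
  simp only [contract12, true_and]
  split_ifs <;> simp_all
  refine Finset.sum_congr rfl fun x _ => ?_
  linear_combination (parity M N θ₀ x * th M N p₂ * parity M N θ₀ q₂ * th M N q₂) * th_mul_self x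

lemma contract12_mul_swap23_mul_contract12 :
    contract12 M N θ₀ * (swap23 M N θ₀ * contract12 M N θ₀) = contract12 M N θ₀ := by
  ext ⟨p₁, p₂, p₃⟩ ⟨q₁, q₂, q₃⟩
  simp only [contract12_mul, swap23_mul]
  have hbar (x : Fin (M + N)) : bar M N x = bar M N p₃ ↔ x = p₃ := by
    rw [bar_eq_iff, bar_bar]
  by_cases h : p₁ = bar M N p₂
  · simp only [contract12, hbar, h, true_and, if_true, ite_and, mul_ite, mul_zero,
      Finset.sum_ite_eq', Finset.mem_univ]
    split_ifs <;> try rfl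
    rw [braidSign_self]
    linear_combination (th M N p₂ * parity M N θ₀ q₂ * th M N q₂) *
      (parity_mul_self (θ₀ := θ₀) p₃ + parity M N θ₀ p₃ * parity M N θ₀ p₃ * th_mul_self p₃)
  · simp [contract12, h]

lemma toOp_one : toOp M N θ₀ 1 = 1 := by
  ext p q
  rw [toOp_apply, Matrix.one_apply]
  split_ifs with h
  · subst h
    rw [mul_one, Even.neg_one_pow]
    simp only [Nat.even_add, Nat.even_mul]
    tauto
  · simp

lemma toOp_emb12_P : toOp M N θ₀ (emb12 M N (P M N θ₀)) = swap12 M N θ₀ := by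
  ext ⟨p₁, p₂, p₃⟩ ⟨q₁, q₂, q₃⟩
  simp only [toOp_apply, emb12, P, swap12, Prod.mk.injEq, braidSign]
  split_ifs <;> simp_all
  rw [← pow_add]
  apply neg_one_pow_congr
  simp only [Nat.even_add, Nat.even_mul]
  tauto

lemma toOp_emb13_P : toOp M N θ₀ (emb13 M N (P M N θ₀)) =
    swap12 M N θ₀ * swap23 M N θ₀ * swap12 M N θ₀ := by
  ext ⟨p₁, p₂, p₃⟩ ⟨q₁, q₂, q₃⟩
  simp only [mul_swap12, swap12_mul]
  simp only [toOp_apply, emb13, P, swap23, Prod.mk.injEq, braidSign]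
  split_ifs <;> simp_all
  simp only [← pow_add]
  apply neg_one_pow_congr
  simp only [Nat.even_add, Nat.even_mul]
  tauto

lemma toOp_emb23_P : toOp M N θ₀ (emb23 M N (P M N θ₀)) = swap23 M N θ₀ := by
  ext ⟨p₁, p₂, p₃⟩ ⟨q₁, q₂, q₃⟩
  simp only [toOp_apply, emb23, P, swap23, Prod.mk.injEq, braidSign]
  split_ifs <;> simp_all
  rw [← pow_add]
  apply neg_one_pow_congr
  simp only [Nat.even_add, Nat.even_mul]
  tauto

lemma toOp_emb12_K : toOp M N θ₀ (emb12 M N (K M N θ₀)) = contract12 M N θ₀ := by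
  ext ⟨p₁, p₂, p₃⟩ ⟨q₁, q₂, q₃⟩
  simp only [toOp_apply, emb12, K, contract12, parity]
  split_ifs <;> simp_all
  simp only [← mul_assoc, ← pow_add, gr_bar]
  congr 2
  apply neg_one_pow_congr
  simp only [Nat.even_add, Nat.even_mul]
  tauto

lemma toOp_emb13_K : toOp M N θ₀ (emb13 M N (K M N θ₀)) =
    swap23 M N θ₀ * contract12 M N θ₀ * swap23 M N θ₀ := by
  ext ⟨p₁, p₂, p₃⟩ ⟨q₁, q₂, q₃⟩
  simp only [mul_swap23, swap23_mul]
  simp only [toOp_apply, emb13, K, contract12, parity, braidSign]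
  split_ifs <;> simp_all
  rcases gr_eq_zero_or_one (θ₀ := θ₀) q₂ with hq | hq <;>
    rcases gr_eq_zero_or_one (θ₀ := θ₀) p₃ with hp₃ | hp₃ <;>
    rcases gr_eq_zero_or_one (θ₀ := θ₀) q₃ with hq₃ | hq₃ <;>
    norm_num [gr_bar, hq, hp₃, hq₃]

lemma toOp_emb23_K : toOp M N θ₀ (emb23 M N (K M N θ₀)) =
    swap12 M N θ₀ * swap23 M N θ₀ * contract12 M N θ₀ * swap23 M N θ₀ * swap12 M N θ₀ := by
  ext ⟨p₁, p₂, p₃⟩ ⟨q₁, q₂, q₃⟩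
  simp only [mul_swap12, mul_swap23, mul_assoc, swap12_mul, swap23_mul]
  simp only [toOp_apply, emb23, K, contract12, parity, braidSign]
  split_ifs <;> simp_all
  rcases gr_eq_zero_or_one (θ₀ := θ₀) q₁ with hq | hq <;>
    rcases gr_eq_zero_or_one (θ₀ := θ₀) p₃ with hp₃ | hp₃ <;>
    rcases gr_eq_zero_or_one (θ₀ := θ₀) q₃ with hq₃ | hq₃ <;>
    norm_num [gr_bar, hq, hp₃, hq₃]

lemma emb12_R (u : ℂ) : emb12 M N (R M N θ₀ u) =
    1 + u⁻¹ • emb12 M N (P M N θ₀) - (u + kap M N θ₀)⁻¹ • emb12 M N (K M N θ₀) := by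
  ext ⟨p₁, p₂, p₃⟩ ⟨q₁, q₂, q₃⟩
  simp only [emb12, R, Matrix.sub_apply, Matrix.add_apply, Matrix.smul_apply, Matrix.one_apply,
    Prod.mk.injEq]
  split_ifs <;> simp_all

lemma emb13_R (u : ℂ) : emb13 M N (R M N θ₀ u) =
    1 + u⁻¹ • emb13 M N (P M N θ₀) - (u + kap M N θ₀)⁻¹ • emb13 M N (K M N θ₀) := by
  ext ⟨p₁, p₂, p₃⟩ ⟨q₁, q₂, q₃⟩
  simp only [emb13, R, Matrix.sub_apply, Matrix.add_apply, Matrix.smul_apply, Matrix.one_apply,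
    Prod.mk.injEq]
  split_ifs <;> simp_all

lemma emb23_R (u : ℂ) : emb23 M N (R M N θ₀ u) =
    1 + u⁻¹ • emb23 M N (P M N θ₀) - (u + kap M N θ₀)⁻¹ • emb23 M N (K M N θ₀) := by
  ext ⟨p₁, p₂, p₃⟩ ⟨q₁, q₂, q₃⟩
  simp only [emb23, R, Matrix.sub_apply, Matrix.add_apply, Matrix.smul_apply, Matrix.one_apply,
    Prod.mk.injEq]
  split_ifs <;> simp_all

variable (M N θ₀)

/-- the super Yang–Baxter equation
`R₁₂(u) R₁₃(u+v) R₂₃(v) = R₂₃(v) R₁₃(u+v) R₁₂(u)` on the graded triple tensor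
product, for `R(u) = I + P/u - K/(u+κ)` with `2κ = (M-N-2)θ₀`. -/
theorem statement11 (hθ : θ₀ = 1 ∨ θ₀ = -1) (hN : Even N)
    (u v : ℂ) (hu : u ≠ 0) (hv : v ≠ 0) (huv : u + v ≠ 0)
    (huk : u + kap M N θ₀ ≠ 0) (hvk : v + kap M N θ₀ ≠ 0)
    (huvk : u + v + kap M N θ₀ ≠ 0) :
    gmul3 M N θ₀ (emb12 M N (R M N θ₀ u))
        (gmul3 M N θ₀ (emb13 M N (R M N θ₀ (u + v))) (emb23 M N (R M N θ₀ v))) =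
      gmul3 M N θ₀ (emb23 M N (R M N θ₀ v))
        (gmul3 M N θ₀ (emb13 M N (R M N θ₀ (u + v))) (emb12 M N (R M N θ₀ u))) := by
  apply toOp_injective (θ₀ := θ₀)
  simp only [toOp_gmul3, emb12_R, emb13_R, emb23_R, map_add, map_sub, map_smul, toOp_one,
    toOp_emb12_P, toOp_emb13_P, toOp_emb23_P, toOp_emb12_K, toOp_emb13_K, toOp_emb23_K]
  refine yang_baxter_of_brauer_relations (t := θ₀) (ω := (M : ℂ) - N) ?_ rfl
    swap12_mul_self swap23_mul_self swap_braid (swap12_mul_contract12 hθ hN)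
    (contract12_mul_swap12 hθ hN) (contract12_mul_self hθ)
    contract12_mul_swap23_mul_contract12 hu hv huv huk hvk huvk
  rcases hθ with rfl | rfl <;> simp
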